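/- Let n, r, s, q be non-negative integers with 0 ≤ s ≤ min(q, r) and q + (r − s) ≤ n. Let π be a fixed permutation of [n], let x_1, …, x_r ∈ [n] be distinct, and let y_i = π(x_i) for i = 1, …, r. Let (x'_1, y'_1), …, (x'_q, y'_q) be pairs in [n] × [n] such that x'_1, …, x'_q are all distinct, y'_1, …, y'_q are all distinct, and for each i = 1, …, s one has x_i = x'_i or y_i = y'_i. Let π' = Swap(π; x_1, …, x_r). Then P(π'(x'_1) = y'_1 ∧ … ∧ π'(x'_q) = y'_q) ≤ ((n−r)!·(n−q)!)/(n!·(n−q−r+s)!). -/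

import Mathlib

open scoped Classical

/-- The result of the swapping subroutine `Swap(π; x_1, …, x_r)` when the random
choices are `c_1, …, c_r`: for `i = 1, …, r` in order, `π` is replaced by
`π ∘ (x_i c_i)`. -/
noncomputable def swapResult {n r : ℕ} (π : Equiv.Perm (Fin n)) (x c : Fin r → Fin n) :
    Equiv.Perm (Fin n) :=
  (List.ofFn fun i => Equiv.swap (x i) (c i)).foldl (· * ·) π

/-- The set of valid random choices of the swapping subroutine: the `i`-th choice
`c i` is drawn uniformly from `[n] ∖ {x_1, …, x_{i-1}}`.  All valid choice tuples
are equally likely. -/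
noncomputable def swapChoices (n r : ℕ) (x : Fin r → Fin n) : Finset (Fin r → Fin n) :=
  Finset.univ.filter fun c => ∀ i j : Fin r, j < i → c i ≠ x j

theorem card_swapChoices {n r : ℕ} {x : Fin r → Fin n} (hx : Function.Injective x) :
    (swapChoices n r x).card = n.descFactorial r := by
  have h : swapChoices n r x =
      Fintype.piFinset fun i : Fin r => ((Finset.Iio i).image x)ᶜ := by
    ext c
    simp only [swapChoices, Finset.mem_filter, Finset.mem_univ, true_and,
      Fintype.mem_piFinset, Finset.mem_compl, Finset.mem_image, Finset.mem_Iio, not_exists,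
      not_and]
    exact forall_congr' fun i => forall_congr' fun j => imp_congr_right fun _ => ne_comm
  rw [h, Fintype.card_piFinset, Nat.descFactorial_eq_prod_range,
    ← Fin.prod_univ_eq_prod_range (fun i => n - i)]
  refine Finset.prod_congr rfl fun i _ => ?_
  rw [Finset.card_compl, Finset.card_image_of_injective _ hx, Fin.card_Iio, Fintype.card_fin]

theorem swapResult_eq_mul {n r : ℕ} (π : Equiv.Perm (Fin n)) (x c : Fin r → Fin n) :
    swapResult π x c = π * (List.ofFn fun i => Equiv.swap (x i) (c i)).prod := by
  conv_lhs => rw [swapResult, ← mul_one π, List.foldl_assoc]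
  rw [List.prod_eq_foldl]

theorem swapResult_one_succ {n r : ℕ} (x c : Fin (r + 1) → Fin n) :
    swapResult 1 x c = Equiv.swap (x 0) (c 0) * swapResult 1 (Fin.tail x) (Fin.tail c) := by
  simp [swapResult_eq_mul, List.ofFn_succ, Fin.tail]

theorem swapResult_one_apply_of_ne {n r : ℕ} (x c : Fin r → Fin n) (a : Fin n)
    (hx : ∀ i, a ≠ x i) (hc : ∀ i, a ≠ c i) : swapResult 1 x c a = a := by
  induction r with
  | zero => simp [swapResult]
  | succ r ih =>
    rw [swapResult_one_succ, Equiv.Perm.mul_apply,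
      ih (Fin.tail x) (Fin.tail c) (fun i => hx i.succ) (fun i => hc i.succ),
      Equiv.swap_apply_of_ne_of_ne (hx 0) (hc 0)]

/-- The valid choices for which the swapping subroutine, run on the identity, produces a
permutation mapping each `x' i` to `y' i`. -/
noncomputable def constrainedChoices {n r q : ℕ} (x : Fin r → Fin n) (x' y' : Fin q → Fin n) :
    Finset (Fin r → Fin n) :=
  (swapChoices n r x).filter fun c => ∀ i, swapResult 1 x c (x' i) = y' i

theorem mem_constrainedChoices {n r q : ℕ} {x c : Fin r → Fin n} {x' y' : Fin q → Fin n} :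
    c ∈ constrainedChoices x x' y' ↔
      c ∈ swapChoices n r x ∧ ∀ i, swapResult 1 x c (x' i) = y' i := by
  simp [constrainedChoices]

theorem tail_mem_swapChoices {n r : ℕ} {x c : Fin (r + 1) → Fin n}
    (h : c ∈ swapChoices n (r + 1) x) : Fin.tail c ∈ swapChoices n r (Fin.tail x) := by
  simp only [swapChoices, Finset.mem_filter, Finset.mem_univ, true_and] at h ⊢
  exact fun i j hij => h i.succ j.succ (Fin.succ_lt_succ_iff.2 hij)

theorem swapResult_tail_apply_zero {n r : ℕ} {x c : Fin (r + 1) → Fin n}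
    (hx : Function.Injective x) (h : c ∈ swapChoices n (r + 1) x) :
    swapResult 1 (Fin.tail x) (Fin.tail c) (x 0) = x 0 := by
  simp only [swapChoices, Finset.mem_filter, Finset.mem_univ, true_and] at h
  exact swapResult_one_apply_of_ne _ _ _ (fun i => hx.ne (Fin.succ_ne_zero i).symm)
    fun i => (h i.succ 0 (Fin.succ_pos i)).symm

theorem swapResult_tail_apply {n r : ℕ} (x c : Fin (r + 1) → Fin n) (a : Fin n) :
    swapResult 1 (Fin.tail x) (Fin.tail c) a =
      Equiv.swap (x 0) (c 0) (swapResult 1 x c a) := by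
  simp [swapResult_one_succ]

/-- Dropping the first choice is injective on a set of choices where the first choice is a
function of the remaining ones. -/
theorem card_le_card_of_tail {n r : ℕ} {s : Finset (Fin (r + 1) → Fin n)}
    {t : Finset (Fin r → Fin n)} (hst : ∀ c ∈ s, Fin.tail c ∈ t)
    (f : (Fin r → Fin n) → Fin n) (hf : ∀ c ∈ s, c 0 = f (Fin.tail c)) : s.card ≤ t.card := by
  refine Finset.card_le_card_of_injOn Fin.tail hst fun c hc d hd hcd => ?_
  rw [← Fin.cons_self_tail c, ← Fin.cons_self_tail d, hf c hc, hf d hd, hcd]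

theorem card_constrainedChoices_le_tail_left {n r q : ℕ} {x : Fin (r + 1) → Fin n}
    (hx : Function.Injective x) (x' y' : Fin q → Fin n) (j : Fin q) (hj : x' j = x 0) :
    (constrainedChoices x x' y').card ≤
      (constrainedChoices (Fin.tail x) x' (Equiv.swap (x 0) (y' j) ∘ y')).card := by
  have key : ∀ c ∈ constrainedChoices x x' y', c 0 = y' j := by
    intro c hc
    rw [mem_constrainedChoices] at hc
    rw [← hc.2 j, hj, swapResult_one_succ, Equiv.Perm.mul_apply,
      swapResult_tail_apply_zero hx hc.1, Equiv.swap_apply_left]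
  refine card_le_card_of_tail (fun c hc => ?_) (fun _ => y' j) key
  have h0 := key c hc
  rw [mem_constrainedChoices] at hc ⊢
  refine ⟨tail_mem_swapChoices hc.1, fun i => ?_⟩
  rw [swapResult_tail_apply, hc.2 i, h0, Function.comp_apply]

theorem card_constrainedChoices_le_tail_right {n r q : ℕ} {x : Fin (r + 1) → Fin n}
    (hx : Function.Injective x) {x' y' : Fin q → Fin n} (hx' : Function.Injective x')
    (hy' : Function.Injective y') (j : Fin q) (hj : y' j = x 0) :
    (constrainedChoices x x' y').card ≤
      (constrainedChoices (Fin.tail x) (Equiv.swap (x 0) (x' j) ∘ x') y').card := by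
  have key : ∀ c ∈ constrainedChoices x x' y',
      c 0 = swapResult 1 (Fin.tail x) (Fin.tail c) (x' j) := by
    intro c hc
    rw [mem_constrainedChoices] at hc
    rw [swapResult_tail_apply, hc.2 j, hj, Equiv.swap_apply_left]
  refine card_le_card_of_tail (fun c hc => ?_) (fun d => swapResult 1 (Fin.tail x) d (x' j)) key
  have h0 := key c hc
  rw [mem_constrainedChoices] at hc ⊢
  refine ⟨tail_mem_swapChoices hc.1, fun i => ?_⟩
  have hfix := swapResult_tail_apply_zero hx hc.1
  have h := swapResult_tail_apply x c (x' i)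
  rw [hc.2 i] at h
  rw [Function.comp_apply]
  by_cases hij : i = j
  · subst hij
    rw [Equiv.swap_apply_right, hfix, hj]
  by_cases hi : x' i = x 0
  · rw [hi, hfix] at h
    rw [hi, Equiv.swap_apply_left, ← h0, ← Equiv.swap_apply_left (x 0) (c 0)]
    exact Equiv.swap_apply_eq_iff.2 h
  · rw [Equiv.swap_apply_of_ne_of_ne hi (hx'.ne hij), h]
    refine Equiv.swap_apply_of_ne_of_ne (hj ▸ hy'.ne hij) fun hyc => hi ?_
    rw [hyc, Equiv.swap_apply_right] at h
    exact Equiv.injective _ (h.trans hfix.symm)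

/-- A constraint involving `x 0` can be turned into the constraint that `x 0` is fixed, at the
price of modifying the other constraints. -/
theorem exists_card_constrainedChoices_le_tail {n r q : ℕ} {x : Fin (r + 1) → Fin n}
    (hx : Function.Injective x) {x' y' : Fin q → Fin n} (hx' : Function.Injective x')
    (hy' : Function.Injective y') (j : Fin q) (hj : x 0 = x' j ∨ x 0 = y' j) :
    ∃ x'' y'' : Fin q → Fin n, Function.Injective x'' ∧ Function.Injective y'' ∧
      (∀ i ≠ j, ∀ a ≠ x 0, a = x' i ∨ a = y' i → a = x'' i ∨ a = y'' i) ∧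
      (constrainedChoices x x' y').card ≤ (constrainedChoices (Fin.tail x) x'' y'').card := by
  rcases hj with hj | hj
  · refine ⟨x', Equiv.swap (x 0) (y' j) ∘ y', hx', (Equiv.injective _).comp hy', ?_,
      card_constrainedChoices_le_tail_left hx x' y' j hj.symm⟩
    rintro i hij a ha (rfl | rfl)
    · exact Or.inl rfl
    · exact Or.inr (Equiv.swap_apply_of_ne_of_ne ha (hy'.ne hij)).symm
  · refine ⟨Equiv.swap (x 0) (x' j) ∘ x', y', (Equiv.injective _).comp hx', hy', ?_,
      card_constrainedChoices_le_tail_right hx hx' hy' j hj.symm⟩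
    rintro i hij a ha (rfl | rfl)
    · exact Or.inl (Equiv.swap_apply_of_ne_of_ne ha (hx'.ne hij)).symm
    · exact Or.inr rfl

/-- If no constraint prescribes the image of `a`, then the possible images of `a` are the elements
that are not yet prescribed as images. -/
theorem card_constrainedChoices_le_mul {n r q : ℕ} (x : Fin r → Fin n) {x' y' : Fin q → Fin n}
    (hy' : Function.Injective y') (a : Fin n) (ha : ∀ i, a ≠ x' i) (k : ℕ)
    (hk : ∀ b, (∀ i, b ≠ y' i) →
      (constrainedChoices x (Fin.cons a x' : Fin (q + 1) → Fin n) (Fin.cons b y')).card ≤ k) :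
    (constrainedChoices x x' y').card ≤ (n - q) * k := by
  have himage : (constrainedChoices x x' y').image (fun c => swapResult 1 x c a) ⊆
      (Finset.univ.image y')ᶜ := by
    intro b hb
    obtain ⟨c, hc, rfl⟩ := Finset.mem_image.1 hb
    rw [mem_constrainedChoices] at hc
    simp only [Finset.mem_compl, Finset.mem_image, Finset.mem_univ, true_and, not_exists]
    intro i hi
    rw [← hc.2 i] at hi
    exact ha i (Equiv.injective _ hi).symm
  have hcard : ((Finset.univ.image y')ᶜ).card = n - q := by
    rw [Finset.card_compl, Finset.card_image_of_injective _ hy', Finset.card_univ,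
      Fintype.card_fin, Fintype.card_fin]
  rw [mul_comm, ← hcard]
  refine (Finset.card_le_mul_card_image _ k fun b hb => ?_).trans
    (Nat.mul_le_mul_left k (Finset.card_le_card himage))
  refine le_trans (Finset.card_le_card fun c hc => ?_) (hk b ?_)
  · rw [Finset.mem_filter, mem_constrainedChoices] at hc
    rw [mem_constrainedChoices]
    exact ⟨hc.1.1, Fin.cases hc.2 hc.1.2⟩
  · rintro i rfl
    simpa using himage hb

theorem card_constrainedChoices_le {n r s q : ℕ} (hs : s ≤ r) (hn : q + (r - s) ≤ n)
    {x : Fin r → Fin n} (hx : Function.Injective x) {x' y' : Fin q → Fin n}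
    (hx' : Function.Injective x') (hy' : Function.Injective y') (e : Fin s → Fin q)
    (he : Function.Injective e)
    (h : ∀ i, x (Fin.castLE hs i) = x' (e i) ∨ x (Fin.castLE hs i) = y' (e i)) :
    (constrainedChoices x x' y').card ≤ (n - q).descFactorial (r - s) := by
  induction r generalizing s q with
  | zero =>
    rw [Nat.zero_sub, Nat.descFactorial_zero]
    exact Finset.card_le_one_of_subsingleton _
  | succ r ih =>
    have hxt : Function.Injective (Fin.tail x) := hx.comp (Fin.succ_injective r)
    cases s with
    | succ s =>
      obtain ⟨x'', y'', hx'', hy'', hover, hle⟩ :=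
        exists_card_constrainedChoices_le_tail hx hx' hy' (e 0) (h 0)
      rw [Nat.add_sub_add_right] at hn ⊢
      exact hle.trans <| ih (Nat.le_of_succ_le_succ hs) hn hxt hx'' hy'' (e ∘ Fin.succ)
        (he.comp (Fin.succ_injective s)) fun i =>
          hover _ (he.ne (Fin.succ_ne_zero i)) _ (hx.ne (Fin.succ_ne_zero _)) (h i.succ)
    | zero =>
      have bound {p : ℕ} {u v : Fin p → Fin n} (hu : Function.Injective u)
          (hv : Function.Injective v) (hp : p + r ≤ n) (j : Fin p)
          (hj : x 0 = u j ∨ x 0 = v j) :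
          (constrainedChoices x u v).card ≤ (n - p).descFactorial r := by
        obtain ⟨x'', y'', hx'', hy'', -, hle⟩ :=
          exists_card_constrainedChoices_le_tail hx hu hv j hj
        exact hle.trans (ih (Nat.zero_le r) hp hxt hx'' hy'' Fin.elim0
          (Function.injective_of_subsingleton _) fun i => i.elim0)
      rw [Nat.sub_zero] at hn ⊢
      by_cases hhit : ∃ j, x 0 = x' j ∨ x 0 = y' j
      · obtain ⟨j, hj⟩ := hhit
        refine (bound hx' hy' (by omega) j hj).trans ?_
        rw [Nat.descFactorial_succ]
        exact Nat.le_mul_of_pos_left _ (by omega)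
      · push Not at hhit
        obtain ⟨m, hm⟩ : ∃ m, n - q = m + 1 := ⟨n - q - 1, by omega⟩
        rw [hm, Nat.succ_descFactorial_succ, ← hm]
        refine card_constrainedChoices_le_mul x hy' (x 0) (fun i => (hhit i).1) _ fun b hb => ?_
        have hm' : m = n - (q + 1) := by omega
        rw [hm']
        refine bound (Fin.cons_injective_iff.2 ⟨?_, hx'⟩) (Fin.cons_injective_iff.2 ⟨?_, hy'⟩)
          (by omega) 0 (Or.inl rfl)
        · rintro ⟨i, hi⟩
          exact (hhit i).1 hi.symm
        · rintro ⟨i, hi⟩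
          exact hb i hi.symm

/-- The key randomness property of the swapping subroutine: with `y_i = π(x_i)`,
if `x'_1, …, x'_q` are distinct, `y'_1, …, y'_q` are distinct, and for `i ≤ s` we
have `x_i = x'_i` or `y_i = y'_i`, then for `π' = Swap(π; x_1, …, x_r)`,
`P(π'(x'_1) = y'_1 ∧ … ∧ π'(x'_q) = y'_q) ≤ (n−r)!·(n−q)! / (n!·(n−q−r+s)!)`.
(The probability is the fraction of equally-likely valid choice tuples realizing
the event; `n + s - q - r` equals `n − q − r + s`, which is a genuine natural
number thanks to `q + (r − s) ≤ n` and `s ≤ r`.) -/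
theorem swap_constraint_probability (n r s q : ℕ)
    (hs : s ≤ min q r) (hn : q + (r - s) ≤ n)
    (π : Equiv.Perm (Fin n)) (x : Fin r → Fin n) (hx : Function.Injective x)
    (x' y' : Fin q → Fin n)
    (hx' : Function.Injective x') (hy' : Function.Injective y')
    (hoverlap : ∀ (i : ℕ) (his : i < s) (hir : i < r) (hiq : i < q),
      x ⟨i, hir⟩ = x' ⟨i, hiq⟩ ∨ π (x ⟨i, hir⟩) = y' ⟨i, hiq⟩) :
    ((((swapChoices n r x).filter
        fun c => ∀ i : Fin q, swapResult π x c (x' i) = y' i).card : ℝ) /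
      ((swapChoices n r x).card : ℝ)) ≤
    ((Nat.factorial (n - r) : ℝ) * (Nat.factorial (n - q) : ℝ)) /
      ((Nat.factorial n : ℝ) * (Nat.factorial (n + s - q - r) : ℝ)) := by
  have hsr : s ≤ r := hs.trans (min_le_right _ _)
  have hsq : s ≤ q := hs.trans (min_le_left _ _)
  have hrn : r ≤ n := by simpa using Fintype.card_le_of_injective x hx
  have hiff (c : Fin r → Fin n) (i : Fin q) :
      swapResult π x c (x' i) = y' i ↔ swapResult 1 x c (x' i) = (⇑π⁻¹ ∘ y') i := by
    rw [swapResult_eq_mul, swapResult_eq_mul, one_mul, Equiv.Perm.mul_apply,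
      Function.comp_apply, Equiv.Perm.eq_inv_iff_eq]
  have hcount : ((swapChoices n r x).filter
      fun c => ∀ i : Fin q, swapResult π x c (x' i) = y' i).card ≤
      (n - q).descFactorial (r - s) := by
    simp only [hiff]
    exact card_constrainedChoices_le hsr hn hx hx' ((Equiv.injective _).comp hy')
      (Fin.castLE hsq) (Fin.castLE_injective hsq) fun i =>
        (hoverlap i i.2 (i.2.trans_le hsr) (i.2.trans_le hsq)).imp_right
          Equiv.Perm.eq_inv_iff_eq.2
  have h1 : ((n + s - q - r).factorial : ℝ) * (n - q).descFactorial (r - s) =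
      (n - q).factorial := by
    have h : n + s - q - r = n - q - (r - s) := by omega
    rw [h]
    exact_mod_cast Nat.factorial_mul_descFactorial (by omega : r - s ≤ n - q)
  have h2 : ((n - r).factorial : ℝ) * n.descFactorial r = n.factorial := by
    exact_mod_cast Nat.factorial_mul_descFactorial hrn
  have hpos : (0 : ℝ) < n.descFactorial r := by
    exact_mod_cast Nat.descFactorial_pos.2 hrn
  rw [card_swapChoices hx, ← h1, ← h2]
  have hf1 : ((n - r).factorial : ℝ) ≠ 0 := by positivity
  have hf2 : ((n + s - q - r).factorial : ℝ) ≠ 0 := by positivity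
  calc _ ≤ ((n - q).descFactorial (r - s) : ℝ) / n.descFactorial r := by gcongr
    _ = _ := by field_simp
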